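/- arXiv:2605.25614 — 13 statements merged into one kernel-verified Lean document; each statement's English description precedes it below -/
import Mathlib

section
/- Let f : [0,1] → ℝ be continuous and suppose there exists a constant α ≥ 0 such that f((s+t)/2) ≤ (f(s)+f(t))/2 − α(t−s)² for all s, t ∈ [0,1]. Then f(λ) ≤ (1−λ)f(0) + λf(1) − 4αλ(1−λ) for all λ ∈ [0,1]. -/
/-- A continuous midpoint-convex function on `[0,1]` which is nonpositive at both endpoints is
nonpositive: at a maximizer, apply midpoint convexity with the nearer endpoint. -/
theorem nonpos_of_midpoint_le_of_endpoints_nonpos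
    {g : ℝ → ℝ} (hg : ContinuousOn g (Set.Icc (0 : ℝ) 1))
    (hmid : ∀ s ∈ Set.Icc (0 : ℝ) 1, ∀ t ∈ Set.Icc (0 : ℝ) 1,
      g ((s + t) / 2) ≤ (g s + g t) / 2)
    (h0 : g 0 ≤ 0) (h1 : g 1 ≤ 0) :
    ∀ l ∈ Set.Icc (0 : ℝ) 1, g l ≤ 0 := by
  obtain ⟨x, hx, hmax⟩ := isCompact_Icc.exists_isMaxOn (Set.nonempty_Icc.2 zero_le_one) hg
  intro l hl
  refine (hmax hl).trans ?_
  rcases le_total x (1 / 2) with h | h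
  · have ht : 2 * x ∈ Set.Icc (0 : ℝ) 1 := ⟨by linarith [hx.1], by linarith⟩
    have hm := hmid 0 (by simp) (2 * x) ht
    rw [show (0 + 2 * x) / 2 = x by ring] at hm
    have : g (2 * x) ≤ g x := hmax ht
    linarith
  · have ht : 2 * x - 1 ∈ Set.Icc (0 : ℝ) 1 := ⟨by linarith, by linarith [hx.2]⟩
    have hm := hmid (2 * x - 1) ht 1 (by simp)
    rw [show (2 * x - 1 + 1) / 2 = x by ring] at hm
    have : g (2 * x - 1) ≤ g x := hmax ht
    linarith

/-- Lemma 2.1: If `f : [0,1] → ℝ` is continuous and satisfies the strengthened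
midpoint inequality `f((s+t)/2) ≤ (f s + f t)/2 - α (t - s)^2` on `[0,1]` with `α ≥ 0`,
then `f l ≤ (1 - l) f 0 + l f 1 - 4 α l (1 - l)` for all `l ∈ [0,1]`. -/
theorem strong_midpoint_implies_strong_chord
    (f : ℝ → ℝ) (hf : ContinuousOn f (Set.Icc (0 : ℝ) 1))
    (α : ℝ) (hα : 0 ≤ α)
    (hmid : ∀ s ∈ Set.Icc (0 : ℝ) 1, ∀ t ∈ Set.Icc (0 : ℝ) 1,
      f ((s + t) / 2) ≤ (f s + f t) / 2 - α * (t - s) ^ 2) :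
    ∀ l ∈ Set.Icc (0 : ℝ) 1,
      f l ≤ (1 - l) * f 0 + l * f 1 - 4 * α * l * (1 - l) := by
  intro l hl
  have key := nonpos_of_midpoint_le_of_endpoints_nonpos
    (g := fun x => f x - ((1 - x) * f 0 + x * f 1 - 4 * α * x * (1 - x)))
    (hf.sub (by fun_prop)) ?_ (by simp) (by simp) l hl
  · exact sub_nonpos.1 key
  · intro s hs t ht
    linear_combination hmid s hs t ht
end

section
/- Let C ⊆ ℝⁿ be a nonempty convex set and let f : C → ℝ be continuous. Suppose there exists a constant μ ≥ 0 such that f((x₁+x₂)/2) ≤ (f(x₁)+f(x₂))/2 − μ‖x₁−x₂‖₂² for all x₁, x₂ ∈ C. Then f is σ-strongly quasiconvex on C with σ = 8μ, i.e., f(λx + (1−λ)y) ≤ max{f(x), f(y)} − (σ/2)λ(1−λ)‖x−y‖₂² for all x, y ∈ C and all λ ∈ (0,1). -/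
/-- A continuous midpoint-convex function on `[0, 1]` which is nonpositive at both endpoints is
nonpositive. -/
theorem nonpos_of_midpoint_convex_of_continuousOn {g : ℝ → ℝ}
    (hg : ContinuousOn g (Set.Icc 0 1))
    (hmid : ∀ s ∈ Set.Icc (0 : ℝ) 1, ∀ t ∈ Set.Icc (0 : ℝ) 1,
      g ((s + t) / 2) ≤ (g s + g t) / 2)
    (h0 : g 0 ≤ 0) (h1 : g 1 ≤ 0) {t : ℝ} (ht : t ∈ Set.Icc (0 : ℝ) 1) : g t ≤ 0 := by
  obtain ⟨c, hc, hmax⟩ := isCompact_Icc.exists_isMaxOn ⟨t, ht⟩ hg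
  by_contra! hpos
  have hMpos : 0 < g c := hpos.trans_le (hmax ht)
  have hcompact : IsCompact (Set.Icc (0 : ℝ) 1 ∩ g ⁻¹' {g c}) :=
    isCompact_Icc.of_isClosed_subset
      (hg.preimage_isClosed_of_isClosed isClosed_Icc isClosed_singleton) Set.inter_subset_left
  obtain ⟨a, ⟨⟨ha0, ha1⟩, hga⟩, hleast⟩ := hcompact.exists_isLeast ⟨c, hc, rfl⟩
  have hga : g a = g c := hga
  have hane0 : a ≠ 0 := by rintro rfl; linarith
  have hane1 : a ≠ 1 := by rintro rfl; linarith
  have hapos : 0 < a := lt_of_le_of_ne ha0 hane0.symm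
  have halt : a < 1 := lt_of_le_of_ne ha1 hane1
  obtain ⟨d, hd, hda, hd1⟩ : ∃ d : ℝ, 0 < d ∧ d ≤ a ∧ d ≤ 1 - a :=
    ⟨min a (1 - a), lt_min hapos (by linarith), min_le_left _ _, min_le_right _ _⟩
  have hl : a - d ∈ Set.Icc (0 : ℝ) 1 := ⟨by linarith, by linarith⟩
  have hr : a + d ∈ Set.Icc (0 : ℝ) 1 := ⟨by linarith, by linarith⟩
  have hm := hmid _ hl _ hr
  rw [show (a - d + (a + d)) / 2 = a by ring] at hm
  have hgl : g (a - d) ≤ g c := hmax hl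
  have hgr : g (a + d) ≤ g c := hmax hr
  have hle : a ≤ a - d := hleast ⟨hl, show g (a - d) = g c by linarith⟩
  linarith


/-- Proposition 2.2: If a continuous function `f` on a nonempty convex set
`C ⊆ ℝⁿ` satisfies the strengthened midpoint inequality with modulus `μ ≥ 0`,
then `f` is `σ`-strongly quasiconvex on `C` with `σ = 8μ`. -/
theorem strong_midpoint_implies_strong_quasiconvex
    (n : ℕ) (C : Set (EuclideanSpace ℝ (Fin n)))
    (hCne : C.Nonempty) (hCconv : Convex ℝ C)
    (f : EuclideanSpace ℝ (Fin n) → ℝ) (hf : ContinuousOn f C)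
    (μ : ℝ) (hμ : 0 ≤ μ)
    (hmid : ∀ x₁ ∈ C, ∀ x₂ ∈ C,
      f ((1 / 2 : ℝ) • (x₁ + x₂)) ≤ (f x₁ + f x₂) / 2 - μ * ‖x₁ - x₂‖ ^ 2) :
    ∀ x ∈ C, ∀ y ∈ C, ∀ l ∈ Set.Ioo (0 : ℝ) 1,
      f (l • x + (1 - l) • y) ≤
        max (f x) (f y) - (8 * μ) / 2 * l * (1 - l) * ‖x - y‖ ^ 2 := by
  intro x hx y hy l hl
  have hmem : ∀ t ∈ Set.Icc (0 : ℝ) 1, t • x + (1 - t) • y ∈ C := fun t ht =>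
    hCconv hx hy ht.1 (by linarith [ht.2]) (by ring)
  have hcont : ContinuousOn (fun t : ℝ => f (t • x + (1 - t) • y)) (Set.Icc 0 1) :=
    hf.comp (by fun_prop) hmem
  have key : f (l • x + (1 - l) • y) + 4 * μ * l * (1 - l) * ‖x - y‖ ^ 2
      - l * f x - (1 - l) * f y ≤ 0 := by
    refine nonpos_of_midpoint_convex_of_continuousOn
      (g := fun t => f (t • x + (1 - t) • y) + 4 * μ * t * (1 - t) * ‖x - y‖ ^ 2
        - t * f x - (1 - t) * f y)
      (((hcont.add (by fun_prop)).sub (by fun_prop)).sub (by fun_prop)) ?_ (by simp) (by simp)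
      ⟨hl.1.le, hl.2.le⟩
    intro s hs t ht
    have h := hmid _ (hmem s hs) _ (hmem t ht)
    have hpt : (1 / 2 : ℝ) • (s • x + (1 - s) • y + (t • x + (1 - t) • y))
        = ((s + t) / 2) • x + (1 - (s + t) / 2) • y := by module
    have hdiff : s • x + (1 - s) • y - (t • x + (1 - t) • y) = (s - t) • (x - y) := by module
    rw [hpt, hdiff, norm_smul, mul_pow, Real.norm_eq_abs, sq_abs] at h
    linear_combination h
  have hxm := mul_le_mul_of_nonneg_left (le_max_left (f x) (f y)) hl.1.le
  have hym := mul_le_mul_of_nonneg_left (le_max_right (f x) (f y)) (sub_nonneg.2 hl.2.le)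
  linear_combination key + hxm + hym
end

section
/- Let ‖·‖ be an arbitrary norm on ℝⁿ, let x₀, v ∈ ℝⁿ with ‖v‖ = 1, and let I ⊆ ℝ be a nonempty interval. Define φ : ℝ → ℝ by φ(t) = ‖x₀ + t v‖. If there exists a constant σ > 0 such that φ is σ-strongly quasiconvex on I, then I is bounded. -/
/-- Lemma 2.3: Let `N` be an arbitrary norm on `ℝⁿ`, `‖v‖ = 1` (in the norm `N`),
and let `I ⊆ ℝ` be a nonempty interval. If `φ(t) = N (x₀ + t v)` is
`σ`-strongly quasiconvex on `I` for some `σ > 0`, then `I` is bounded. -/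
theorem interval_bounded_of_strong_quasiconvex_norm_on_line
    (n : ℕ) (N : EuclideanSpace ℝ (Fin n) → ℝ)
    (hN0 : ∀ x, N x = 0 ↔ x = 0)
    (hNsmul : ∀ (c : ℝ) (x), N (c • x) = |c| * N x)
    (hNadd : ∀ x y, N (x + y) ≤ N x + N y)
    (x₀ v : EuclideanSpace ℝ (Fin n)) (hv : N v = 1)
    (I : Set ℝ) (hIne : I.Nonempty) (hIint : I.OrdConnected)
    (σ : ℝ) (hσ : 0 < σ)
    (hsq : ∀ s ∈ I, ∀ t ∈ I, ∀ l ∈ Set.Ioo (0 : ℝ) 1,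
      N (x₀ + (l * s + (1 - l) * t) • v) ≤
        max (N (x₀ + s • v)) (N (x₀ + t • v)) - σ / 2 * l * (1 - l) * |s - t| ^ 2) :
    Bornology.IsBounded I := by
  have lipschitz (a b : ℝ) : N (x₀ + a • v) ≤ N (x₀ + b • v) + |a - b| := by
    have h := hNadd (x₀ + b • v) ((a - b) • v)
    rwa [hNsmul, hv, mul_one, add_assoc, ← add_smul, add_sub_cancel] at h
  refine Metric.isBounded_iff.2 ⟨4 / σ, fun s hs t ht => ?_⟩
  rw [Real.dist_eq, le_div_iff₀ hσ]
  have hmid := hsq s hs t ht (1 / 2) ⟨by norm_num, by norm_num⟩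
  set m : ℝ := 1 / 2 * s + (1 - 1 / 2) * t with hm
  have hsm : |s - m| = |s - t| / 2 := by
    rw [show s - m = (s - t) / 2 by rw [hm]; ring, abs_div, abs_two]
  have htm : |t - m| = |s - t| / 2 := by
    rw [show t - m = (t - s) / 2 by rw [hm]; ring, abs_div, abs_two, abs_sub_comm]
  have hmax : max (N (x₀ + s • v)) (N (x₀ + t • v)) ≤ N (x₀ + m • v) + |s - t| / 2 :=
    max_le (hsm ▸ lipschitz s m) (htm ▸ lipschitz t m)
  rcases (abs_nonneg (s - t)).eq_or_lt with h | h
  · rw [← h]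
    norm_num
  · refine le_of_mul_le_mul_right ?_ h
    linarith
end

section
/- Let ‖·‖ be an arbitrary norm on ℝⁿ and let C ⊆ ℝⁿ be a nonempty convex set. If there exists a constant σ > 0 such that the norm function f(x) = ‖x‖ is σ-strongly quasiconvex on C (with the Euclidean norm in the penalty term), then C is bounded. -/
/-- A subadditive, absolutely homogeneous function on `ℝⁿ` is dominated by a multiple of the
Euclidean norm. -/
theorem exists_le_mul_norm_of_subadditive_homogeneous
    {n : ℕ} {N : EuclideanSpace ℝ (Fin n) → ℝ}
    (hNsmul : ∀ (c : ℝ) (x), N (c • x) = |c| * N x)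
    (hNadd : ∀ x y, N (x + y) ≤ N x + N y) :
    ∃ K : ℝ, 0 ≤ K ∧ ∀ x, N x ≤ K * ‖x‖ := by
  let p : Seminorm ℝ (EuclideanSpace ℝ (Fin n)) := Seminorm.of N hNadd hNsmul
  let b := EuclideanSpace.basisFun (Fin n) ℝ
  refine ⟨∑ i, p (b i), Finset.sum_nonneg fun i _ => apply_nonneg p _, fun x => ?_⟩
  calc N x = p (∑ i, x i • b i) := by
        conv_lhs => rw [← b.sum_repr x]
        rfl
    _ ≤ ∑ i, p (x i • b i) := Finset.le_sum_of_subadditive p (map_zero p).le (map_add_le_add p) _ _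
    _ ≤ ∑ i, p (b i) * ‖x‖ := by
        refine Finset.sum_le_sum fun i _ => ?_
        rw [map_smul_eq_mul, mul_comm]
        exact mul_le_mul_of_nonneg_left (PiLp.norm_apply_le x i) (apply_nonneg p _)
    _ = (∑ i, p (b i)) * ‖x‖ := (Finset.sum_mul ..).symm

/-- Theorem 2.5: If `N` is an arbitrary norm on `ℝⁿ` and the norm function
`f(x) = N x` is `σ`-strongly quasiconvex (with Euclidean penalty term) on a
nonempty convex set `C` for some `σ > 0`, then `C` is bounded. -/
theorem bounded_of_strong_quasiconvex_norm
    (n : ℕ) (N : EuclideanSpace ℝ (Fin n) → ℝ)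
    (hN0 : ∀ x, N x = 0 ↔ x = 0)
    (hNsmul : ∀ (c : ℝ) (x), N (c • x) = |c| * N x)
    (hNadd : ∀ x y, N (x + y) ≤ N x + N y)
    (C : Set (EuclideanSpace ℝ (Fin n)))
    (hCne : C.Nonempty) (hCconv : Convex ℝ C)
    (σ : ℝ) (hσ : 0 < σ)
    (hsq : ∀ x ∈ C, ∀ y ∈ C, ∀ l ∈ Set.Ioo (0 : ℝ) 1,
      N (l • x + (1 - l) • y) ≤
        max (N x) (N y) - σ / 2 * l * (1 - l) * ‖x - y‖ ^ 2) :
    Bornology.IsBounded C := by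
  obtain ⟨K, hK0, hK⟩ := exists_le_mul_norm_of_subadditive_homogeneous hNsmul hNadd
  obtain ⟨x, hx⟩ := hCne
  refine (Metric.isBounded_iff_subset_closedBall x).mpr ⟨4 * K / σ, fun y hy => ?_⟩
  rw [Metric.mem_closedBall, dist_comm, dist_eq_norm]
  have hmid := hsq x hx y hy (1 / 2) ⟨by norm_num, by norm_num⟩
  set m := (1 / 2 : ℝ) • x + (1 - 1 / 2 : ℝ) • y with hm
  have hNx : N x ≤ N m + 1 / 2 * N (x - y) := by
    have h := hNadd m ((1 / 2 : ℝ) • (x - y))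
    rw [hNsmul, abs_of_pos (by norm_num : (0 : ℝ) < 1 / 2)] at h
    convert h using 2
    rw [hm]
    module
  have hNy : N y ≤ N m + 1 / 2 * N (x - y) := by
    have h := hNadd m ((-(1 / 2) : ℝ) • (x - y))
    rw [hNsmul, abs_neg, abs_of_pos (by norm_num : (0 : ℝ) < 1 / 2)] at h
    convert h using 2
    rw [hm]
    module
  have hmax := max_le hNx hNy
  have hKxy := hK (x - y)
  have hquad : σ * ‖x - y‖ * ‖x - y‖ ≤ 4 * K * ‖x - y‖ := by nlinarith
  rw [le_div_iff₀ hσ, mul_comm]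
  rcases (norm_nonneg (x - y)).eq_or_lt with h | h
  · rw [← h]
    linarith
  · exact le_of_mul_le_mul_right hquad h
end

section
/- Let 1 < p ≤ 2 and equip ℝⁿ with the ℓp-norm ‖x‖ₚ = (∑ᵢ |xᵢ|^p)^{1/p}. Let C ⊆ ℝⁿ be a nonempty convex set. Then the norm function f(x) = ‖x‖ₚ is σ-strongly quasiconvex on C for some σ > 0 if and only if C is bounded. -/
theorem hasDerivAt_rpow_sub_mul_sq (p R : ℝ) {s : ℝ} (hs : 0 < s) :
    HasDerivAt (fun s ↦ s ^ p - p * (p - 1) / 2 * R ^ (p - 2) * s ^ 2)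
      (p * s ^ (p - 1) - p * (p - 1) * R ^ (p - 2) * s) s := by
  have h := (Real.hasDerivAt_rpow_const (x := s) (p := p) (Or.inl hs.ne')).sub
    ((hasDerivAt_pow 2 s).const_mul (p * (p - 1) / 2 * R ^ (p - 2)))
  refine h.congr_deriv ?_
  push_cast
  ring

theorem convexOn_rpow_sub_mul_sq {p R : ℝ} (hp1 : 1 < p) (hp2 : p ≤ 2) :
    ConvexOn ℝ (Set.Icc 0 R) fun s ↦ s ^ p - p * (p - 1) / 2 * R ^ (p - 2) * s ^ 2 := by
  have hd2 : ∀ s : ℝ, 0 < s → HasDerivAt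
      (fun s ↦ p * s ^ (p - 1) - p * (p - 1) * R ^ (p - 2) * s)
      (p * (p - 1) * (s ^ (p - 2) - R ^ (p - 2))) s := by
    intro s hs
    have h := ((Real.hasDerivAt_rpow_const (x := s) (p := p - 1) (Or.inl hs.ne')).const_mul p).sub
      ((hasDerivAt_id s).const_mul (p * (p - 1) * R ^ (p - 2)))
    refine h.congr_deriv ?_
    rw [show p - 1 - 1 = p - 2 by ring]
    ring
  refine convexOn_of_hasDerivWithinAt2_nonneg (convex_Icc 0 R) ?_
    (f' := fun s ↦ p * s ^ (p - 1) - p * (p - 1) * R ^ (p - 2) * s)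
    (f'' := fun s ↦ p * (p - 1) * (s ^ (p - 2) - R ^ (p - 2))) ?_ ?_ ?_
  · exact ((Real.continuous_rpow_const (by linarith)).sub (by fun_prop)).continuousOn
  · intro s hs
    rw [interior_Icc] at hs
    exact (hasDerivAt_rpow_sub_mul_sq p R hs.1).hasDerivWithinAt
  · intro s hs
    rw [interior_Icc] at hs
    exact (hd2 s hs.1).hasDerivWithinAt
  · intro s hs
    rw [interior_Icc] at hs
    have h := Real.rpow_le_rpow_of_nonpos hs.1 hs.2.le (by linarith : p - 2 ≤ 0)
    exact mul_nonneg (mul_nonneg (by linarith) (by linarith)) (by linarith)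

theorem monotoneOn_rpow_sub_mul_sq {p R : ℝ} (hp1 : 1 < p) (hp2 : p ≤ 2) :
    MonotoneOn (fun s ↦ s ^ p - p * (p - 1) / 2 * R ^ (p - 2) * s ^ 2) (Set.Icc 0 R) := by
  refine monotoneOn_of_hasDerivWithinAt_nonneg (convex_Icc 0 R)
    (f' := fun s ↦ p * s ^ (p - 1) - p * (p - 1) * R ^ (p - 2) * s) ?_ ?_ ?_
  · exact ((Real.continuous_rpow_const (by linarith)).sub (by fun_prop)).continuousOn
  · intro s hs
    rw [interior_Icc] at hs
    exact (hasDerivAt_rpow_sub_mul_sq p R hs.1).hasDerivWithinAt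
  · intro s hs
    rw [interior_Icc] at hs
    have h := Real.rpow_le_rpow_of_nonpos hs.1 hs.2.le (by linarith : p - 2 ≤ 0)
    have hs1 : s ^ (p - 1) = s ^ (p - 2) * s := by
      rw [← Real.rpow_add_one hs.1.ne']
      ring_nf
    have hR : 0 < R ^ (p - 2) := Real.rpow_pos_of_pos (hs.1.trans hs.2) _
    have h2 : (p - 1) * R ^ (p - 2) ≤ s ^ (p - 2) := by nlinarith
    have h3 : 0 ≤ p * s * (s ^ (p - 2) - (p - 1) * R ^ (p - 2)) :=
      mul_nonneg (mul_nonneg (by linarith) hs.1.le) (by linarith)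
    rw [hs1]
    linarith

/-- On `[-R, R]` the function `t ↦ |t| ^ p` is strongly convex with modulus
`p * (p - 1) * R ^ (p - 2)`. -/
theorem abs_rpow_combo_le {p R : ℝ} (hp1 : 1 < p) (hp2 : p ≤ 2) {a b l : ℝ}
    (ha : |a| ≤ R) (hb : |b| ≤ R) (hl0 : 0 ≤ l) (hl1 : l ≤ 1) :
    |l * a + (1 - l) * b| ^ p ≤ l * |a| ^ p + (1 - l) * |b| ^ p -
      p * (p - 1) / 2 * R ^ (p - 2) * (l * (1 - l) * (a - b) ^ 2) := by
  have hle : |l * a + (1 - l) * b| ≤ l * |a| + (1 - l) * |b| := by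
    refine (abs_add_le _ _).trans ?_
    rw [abs_mul, abs_mul, abs_of_nonneg hl0, abs_of_nonneg (sub_nonneg.2 hl1)]
  have hmem : l * |a| + (1 - l) * |b| ≤ R := by nlinarith
  have hm := monotoneOn_rpow_sub_mul_sq (R := R) hp1 hp2 ⟨abs_nonneg _, hle.trans hmem⟩
    ⟨(abs_nonneg _).trans hle, hmem⟩ hle
  have hc := (convexOn_rpow_sub_mul_sq hp1 hp2).2 ⟨abs_nonneg a, ha⟩ ⟨abs_nonneg b, hb⟩
    hl0 (sub_nonneg.2 hl1) (by ring)
  simp only [smul_eq_mul] at hm hc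
  have h := hm.trans hc
  simp only [sq_abs] at h
  linear_combination h

theorem rpow_sub_rpow_le {p F M B : ℝ} (hp : 1 ≤ p) (hF : 0 ≤ F) (hFM : F ≤ M) (hMB : M ≤ B) :
    M ^ p - F ^ p ≤ p * B ^ (p - 1) * (M - F) := by
  rcases (hF.trans hFM).eq_or_lt with h0 | hM
  · have : F = M := by linarith
    simp [this]
  have h := one_add_mul_self_le_rpow_one_add (s := F / M - 1)
    (by linarith [div_nonneg hF hM.le]) hp
  rw [add_sub_cancel, Real.div_rpow hF hM.le, le_div_iff₀ (Real.rpow_pos_of_pos hM p)] at h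
  have hMp : M ^ p = M ^ (p - 1) * M := by
    rw [← Real.rpow_add_one hM.ne']
    ring_nf
  have h1 : (1 + p * (F / M - 1)) * M ^ p = M ^ p - p * M ^ (p - 1) * (M - F) := by
    rw [hMp]
    field_simp
    ring
  have h2 : M ^ (p - 1) ≤ B ^ (p - 1) := Real.rpow_le_rpow hM.le hMB (by linarith)
  have h3 : p * M ^ (p - 1) * (M - F) ≤ p * B ^ (p - 1) * (M - F) := by
    have : 0 ≤ M - F := by linarith
    gcongr
  linarith

theorem lp_norm_le_mul_norm {n : ℕ} {p : ℝ} (hp : 0 < p) (x : EuclideanSpace ℝ (Fin n)) :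
    (∑ i, |x i| ^ p) ^ (1 / p) ≤ (n : ℝ) ^ (1 / p) * ‖x‖ := by
  have h : ∑ i, |x i| ^ p ≤ n * ‖x‖ ^ p := by
    calc ∑ i, |x i| ^ p ≤ ∑ _i : Fin n, ‖x‖ ^ p := by
          refine Finset.sum_le_sum fun i _ ↦ ?_
          have := PiLp.norm_apply_le x i
          exact Real.rpow_le_rpow (abs_nonneg _) this hp.le
      _ = n * ‖x‖ ^ p := by simp
  calc (∑ i, |x i| ^ p) ^ (1 / p) ≤ (n * ‖x‖ ^ p) ^ (1 / p) :=
        Real.rpow_le_rpow (by positivity) h (by positivity)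
    _ = (n : ℝ) ^ (1 / p) * ‖x‖ := by
        rw [Real.mul_rpow (by positivity) (by positivity), ← Real.rpow_mul (norm_nonneg x),
          mul_one_div_cancel hp.ne', Real.rpow_one]

theorem lp_norm_le_midpoint_add {n : ℕ} {p : ℝ} (hp : 1 ≤ p) (x y : EuclideanSpace ℝ (Fin n)) :
    (∑ i, |x i| ^ p) ^ (1 / p) ≤
      (∑ i, |((1 / 2 : ℝ) • x + (1 - 1 / 2 : ℝ) • y) i| ^ p) ^ (1 / p) +
        (n : ℝ) ^ (1 / p) * (‖x - y‖ / 2) := by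
  have h := Real.Lp_add_le Finset.univ (fun i ↦ ((1 / 2 : ℝ) • x + (1 - 1 / 2 : ℝ) • y) i)
    (fun i ↦ ((1 / 2 : ℝ) • (x - y)) i) hp
  have hx : ∀ i, ((1 / 2 : ℝ) • x + (1 - 1 / 2 : ℝ) • y) i + ((1 / 2 : ℝ) • (x - y)) i = x i := by
    intro i
    simp only [PiLp.add_apply, PiLp.smul_apply, PiLp.sub_apply, smul_eq_mul]
    ring
  simp only [hx] at h
  have h2 := lp_norm_le_mul_norm (by linarith : 0 < p) ((1 / 2 : ℝ) • (x - y))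
  have h3 : ‖(1 / 2 : ℝ) • (x - y)‖ = ‖x - y‖ / 2 := by
    rw [norm_smul, Real.norm_of_nonneg (by norm_num)]
    ring
  rw [h3] at h2
  linarith

theorem sum_abs_rpow_combo_le {n : ℕ} {p R : ℝ} (hp1 : 1 < p) (hp2 : p ≤ 2)
    {x y : EuclideanSpace ℝ (Fin n)} (hx : ‖x‖ ≤ R) (hy : ‖y‖ ≤ R) {l : ℝ}
    (hl0 : 0 ≤ l) (hl1 : l ≤ 1) :
    ∑ i, |(l • x + (1 - l) • y) i| ^ p ≤
      l * ∑ i, |x i| ^ p + (1 - l) * ∑ i, |y i| ^ p -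
        p * (p - 1) / 2 * R ^ (p - 2) * (l * (1 - l) * ‖x - y‖ ^ 2) := by
  rw [EuclideanSpace.real_norm_sq_eq]
  simp only [Finset.mul_sum, ← Finset.sum_add_distrib, ← Finset.sum_sub_distrib]
  refine Finset.sum_le_sum fun i _ ↦ ?_
  exact abs_rpow_combo_le hp1 hp2 ((PiLp.norm_apply_le x i).trans hx)
    ((PiLp.norm_apply_le y i).trans hy) hl0 hl1

/-- Corollary 2.6: For `1 < p ≤ 2`, the `ℓp`-norm function is `σ`-strongly
quasiconvex (with Euclidean penalty term) on a nonempty convex set `C ⊆ ℝⁿ`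
for some `σ > 0` if and only if `C` is bounded. -/
theorem lp_norm_strong_quasiconvex_iff_bounded
    (n : ℕ) (p : ℝ) (hp1 : 1 < p) (hp2 : p ≤ 2)
    (C : Set (EuclideanSpace ℝ (Fin n)))
    (hCne : C.Nonempty) (hCconv : Convex ℝ C) :
    (∃ σ > (0 : ℝ), ∀ x ∈ C, ∀ y ∈ C, ∀ l ∈ Set.Ioo (0 : ℝ) 1,
      (∑ i, |(l • x + (1 - l) • y) i| ^ p) ^ (1 / p) ≤
        max ((∑ i, |x i| ^ p) ^ (1 / p)) ((∑ i, |y i| ^ p) ^ (1 / p)) -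
          σ / 2 * l * (1 - l) * ‖x - y‖ ^ 2) ↔
    Bornology.IsBounded C := by
  have hp0 : 0 < p := by linarith
  constructor
  · rintro ⟨σ, hσ, h⟩
    rw [Metric.isBounded_iff]
    refine ⟨4 * (n : ℝ) ^ (1 / p) / σ, fun x hx y hy ↦ ?_⟩
    have hxy := h x hx y hy (1 / 2) ⟨by norm_num, by norm_num⟩
    have h1 := lp_norm_le_midpoint_add hp1.le x y
    have h2 := lp_norm_le_midpoint_add hp1.le y x
    rw [norm_sub_rev y x, show (1 / 2 : ℝ) • y + (1 - 1 / 2 : ℝ) • x =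
      (1 / 2 : ℝ) • x + (1 - 1 / 2 : ℝ) • y by rw [add_comm]; norm_num] at h2
    have h3 := max_le h1 h2
    rw [dist_eq_norm, le_div_iff₀ hσ]
    rcases (norm_nonneg (x - y)).eq_or_lt with h0 | h0
    · rw [← h0, zero_mul]
      positivity
    · refine le_of_mul_le_mul_right ?_ h0
      linarith
  · intro hC
    obtain ⟨R, hR, hCR⟩ := hC.exists_pos_norm_le
    set B : ℝ := (n : ℝ) ^ (1 / p) * R + 1 with hB
    have hB0 : 0 < B := by positivity
    set k : ℝ := p * (p - 1) / 2 * R ^ (p - 2) with hk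
    have hk0 : 0 < k := by
      have : 0 < p - 1 := by linarith
      positivity
    have hD : 0 < p * B ^ (p - 1) := by positivity
    refine ⟨2 * k / (p * B ^ (p - 1)), by positivity, fun x hx y hy l hl ↦ ?_⟩
    have hsum := sum_abs_rpow_combo_le hp1 hp2 (hCR x hx) (hCR y hy) hl.1.le hl.2.le
    rw [← hk] at hsum
    have hnonneg : ∀ z : EuclideanSpace ℝ (Fin n), 0 ≤ ∑ i, |z i| ^ p :=
      fun z ↦ Finset.sum_nonneg fun i _ ↦ by positivity
    have hpow : ∀ z : EuclideanSpace ℝ (Fin n),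
        ((∑ i, |z i| ^ p) ^ (1 / p)) ^ p = ∑ i, |z i| ^ p := by
      intro z
      rw [← Real.rpow_mul (hnonneg z), one_div_mul_cancel hp0.ne', Real.rpow_one]
    have hbound : ∀ z ∈ C, (∑ i, |z i| ^ p) ^ (1 / p) ≤ B := by
      intro z hz
      have h1 := lp_norm_le_mul_norm hp0 z
      have h2 : (n : ℝ) ^ (1 / p) * ‖z‖ ≤ (n : ℝ) ^ (1 / p) * R := by
        gcongr
        exact hCR z hz
      linarith
    rw [← hpow (l • x + (1 - l) • y), ← hpow x, ← hpow y] at hsum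
    have hF := Real.rpow_nonneg (hnonneg (l • x + (1 - l) • y)) (1 / p)
    have hX := Real.rpow_nonneg (hnonneg x) (1 / p)
    have hY := Real.rpow_nonneg (hnonneg y) (1 / p)
    have hXB := hbound x hx
    have hYB := hbound y hy
    generalize (∑ i, |(l • x + (1 - l) • y) i| ^ p) ^ (1 / p) = F at *
    generalize (∑ i, |x i| ^ p) ^ (1 / p) = X at *
    generalize (∑ i, |y i| ^ p) ^ (1 / p) = Y at *
    have hl0 : 0 < l := hl.1
    have hl1 : 0 < 1 - l := by linarith [hl.2]
    have hXM := Real.rpow_le_rpow hX (le_max_left X Y) hp0.le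
    have hYM := Real.rpow_le_rpow hY (le_max_right X Y) hp0.le
    have hM0 : 0 ≤ max X Y := hX.trans (le_max_left X Y)
    have hMB := max_le hXB hYB
    generalize max X Y = M at *
    have hgap : k * (l * (1 - l) * ‖x - y‖ ^ 2) ≤ M ^ p - F ^ p := by
      have h1 := mul_le_mul_of_nonneg_left hXM hl0.le
      have h2 := mul_le_mul_of_nonneg_left hYM hl1.le
      linarith
    have hFM : F ≤ M := by
      rw [← Real.rpow_le_rpow_iff hF hM0 hp0]
      have : 0 ≤ k * (l * (1 - l) * ‖x - y‖ ^ 2) := by positivity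
      linarith
    have h := hgap.trans (rpow_sub_rpow_le hp1.le hF hFM hMB)
    have h' : k * (l * (1 - l) * ‖x - y‖ ^ 2) / (p * B ^ (p - 1)) ≤ M - F := by
      rw [div_le_iff₀ hD]
      linarith
    have he : 2 * k / (p * B ^ (p - 1)) / 2 * l * (1 - l) * ‖x - y‖ ^ 2 =
        k * (l * (1 - l) * ‖x - y‖ ^ 2) / (p * B ^ (p - 1)) := by
      ring
    rw [he]
    linarith
end

section
/- In Euclidean ℝⁿ, let Ω = {x : ‖x‖₂ ≤ R} be the closed ball of radius R > 0 centered at the origin. Then for every r > R there exists a constant σ₀ > 0 such that for all x₁, x₂ with ‖x₁‖₂ = ‖x₂‖₂ = r and all λ ∈ (0,1), d_Ω((1−λ)x₁ + λx₂) ≤ max{d_Ω(x₁), d_Ω(x₂)} − (σ₀/2)λ(1−λ)‖x₁−x₂‖₂². -/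
theorem norm_sub_le_infDist_closedBall {E : Type*} [NormedAddCommGroup E] {R : ℝ} (hR : 0 ≤ R)
    (x : E) : ‖x‖ - R ≤ Metric.infDist x {y : E | ‖y‖ ≤ R} := by
  refine (Metric.le_infDist ⟨0, by simpa using hR⟩).2 fun y hy => ?_
  have hy' : ‖y‖ ≤ R := hy
  rw [dist_eq_norm]
  linarith [norm_sub_norm_le x y]

theorem infDist_closedBall_le_max {E : Type*} [NormedAddCommGroup E] [NormedSpace ℝ E]
    {R : ℝ} (hR : 0 ≤ R) (x : E) :
    Metric.infDist x {y : E | ‖y‖ ≤ R} ≤ max (‖x‖ - R) 0 := by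
  rcases le_or_gt ‖x‖ R with h | h
  · rw [Metric.infDist_zero_of_mem (show x ∈ {y : E | ‖y‖ ≤ R} from h)]
    exact le_max_right _ _
  · have hx : 0 < ‖x‖ := hR.trans_lt h
    have hmem : (R / ‖x‖) • x ∈ {y : E | ‖y‖ ≤ R} := by
      change ‖(R / ‖x‖) • x‖ ≤ R
      rw [norm_smul, Real.norm_of_nonneg (by positivity), div_mul_cancel₀ _ hx.ne']
    refine (Metric.infDist_le_dist_of_mem hmem).trans (le_trans (le_of_eq ?_) (le_max_left _ _))
    have hsub : x - (R / ‖x‖) • x = (1 - R / ‖x‖) • x := by rw [sub_smul, one_smul]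
    have hnonneg : 0 ≤ 1 - R / ‖x‖ := sub_nonneg.2 ((div_le_one hx).2 h.le)
    rw [dist_eq_norm, hsub, norm_smul, Real.norm_of_nonneg hnonneg, sub_mul, one_mul,
      div_mul_cancel₀ _ hx.ne']

theorem norm_sq_convex_combination {E : Type*} [NormedAddCommGroup E] [InnerProductSpace ℝ E]
    (x y : E) (l : ℝ) :
    ‖(1 - l) • x + l • y‖ ^ 2 =
      (1 - l) * ‖x‖ ^ 2 + l * ‖y‖ ^ 2 - l * (1 - l) * ‖x - y‖ ^ 2 := by
  rw [norm_add_sq_real, norm_sub_sq_real, norm_smul, norm_smul, mul_pow, mul_pow,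
    Real.norm_eq_abs, Real.norm_eq_abs, sq_abs, sq_abs, real_inner_smul_left,
    real_inner_smul_right]
  ring


/-- Proposition 3.2 (first part): For the closed Euclidean ball `Ω` of radius
`R > 0` centered at the origin and any `r > R`, there is `σ₀ > 0` such that the
strong quasiconvexity inequality for `d_Ω` holds along chords joining any two
points of the sphere of radius `r`. -/
theorem distance_strong_quasiconvex_on_sphere_chords
    (n : ℕ) (R : ℝ) (hR : 0 < R) (r : ℝ) (hr : R < r) :
    ∃ σ₀ > (0 : ℝ), ∀ x₁ x₂ : EuclideanSpace ℝ (Fin n),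
      ‖x₁‖ = r → ‖x₂‖ = r → ∀ l ∈ Set.Ioo (0 : ℝ) 1,
        Metric.infDist ((1 - l) • x₁ + l • x₂) {x : EuclideanSpace ℝ (Fin n) | ‖x‖ ≤ R} ≤
          max (Metric.infDist x₁ {x : EuclideanSpace ℝ (Fin n) | ‖x‖ ≤ R})
              (Metric.infDist x₂ {x : EuclideanSpace ℝ (Fin n) | ‖x‖ ≤ R}) -
            σ₀ / 2 * l * (1 - l) * ‖x₁ - x₂‖ ^ 2 := by
  have hr0 : 0 < r := hR.trans hr
  refine ⟨(r - R) / r ^ 2, div_pos (sub_pos.2 hr) (by positivity), ?_⟩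
  intro x₁ x₂ h₁ h₂ l hl
  have hnorm := norm_sq_convex_combination x₁ x₂ l
  have hlow := (norm_sub_le_infDist_closedBall hR.le x₁).trans
    (le_max_left _ (Metric.infDist x₂ {x : EuclideanSpace ℝ (Fin n) | ‖x‖ ≤ R}))
  have hup := infDist_closedBall_le_max hR.le ((1 - l) • x₁ + l • x₂)
  rw [h₁, h₂] at hnorm
  rw [h₁] at hlow
  set m := ‖(1 - l) • x₁ + l • x₂‖
  have hm : 0 ≤ m := norm_nonneg _
  have hq : l * (1 - l) * ‖x₁ - x₂‖ ^ 2 = r ^ 2 - m ^ 2 := by linarith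
  have hq0 : 0 ≤ r ^ 2 - m ^ 2 := by
    rw [← hq]
    exact mul_nonneg (mul_nonneg hl.1.le (sub_nonneg.2 hl.2.le)) (sq_nonneg _)
  have hmr : m ≤ r := by nlinarith
  have hterm : (r - R) / r ^ 2 / 2 * l * (1 - l) * ‖x₁ - x₂‖ ^ 2 =
      (r - R) * (r ^ 2 - m ^ 2) / (2 * r ^ 2) := by
    rw [← hq]
    field_simp
  have hmain : max (m - R) 0 ≤ (r - R) - (r - R) * (r ^ 2 - m ^ 2) / (2 * r ^ 2) := by
    apply max_le
    · have : (r - R) * (r ^ 2 - m ^ 2) / (2 * r ^ 2) ≤ r - m := by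
        rw [div_le_iff₀ (by positivity)]
        have hfac : (r - R) * (r + m) ≤ 2 * r ^ 2 := by nlinarith
        nlinarith [mul_le_mul_of_nonneg_left hfac (sub_nonneg.2 hmr)]
      linarith
    · have : (r - R) * (r ^ 2 - m ^ 2) / (2 * r ^ 2) ≤ r - R := by
        rw [div_le_iff₀ (by positivity)]
        exact mul_le_mul_of_nonneg_left (by nlinarith) (sub_nonneg.2 hr.le)
      linarith
  rw [hterm]
  linarith
end

section
/- In Euclidean ℝⁿ, let Ω = {x : ‖x‖₂ ≤ R} be the closed ball of radius R > 0 centered at the origin, let r > R, and let x₁, x₂ satisfy ‖x₁‖₂ = ‖x₂‖₂ = r. If the segment [x₁,x₂] = {(1−λ)x₁ + λx₂ : λ ∈ [0,1]} satisfies [x₁,x₂] ∩ Ω = ∅, then there exists a constant σ₁ > 0 such that d_Ω is σ₁-strongly quasiconvex on [x₁,x₂], i.e., d_Ω((1−λ)y₁ + λy₂) ≤ max{d_Ω(y₁), d_Ω(y₂)} − (σ₁/2)λ(1−λ)‖y₁−y₂‖₂² for all y₁, y₂ ∈ [x₁,x₂] and all λ ∈ (0,1). -/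
/-- The distance from a point outside a closed ball centred at the origin to that ball. -/
theorem infDist_norm_le {E : Type*} [NormedAddCommGroup E] [NormedSpace ℝ E] {R : ℝ}
    (hR : 0 < R) {x : E} (hx : R < ‖x‖) :
    Metric.infDist x {y : E | ‖y‖ ≤ R} = ‖x‖ - R := by
  have hpos : 0 < ‖x‖ := hR.trans hx
  apply le_antisymm
  · have hmem : (R / ‖x‖) • x ∈ {y : E | ‖y‖ ≤ R} := by
      simp only [Set.mem_ofPred_eq, norm_smul, Real.norm_eq_abs]
      rw [abs_of_pos (div_pos hR hpos), div_mul_cancel₀ _ hpos.ne']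
    refine (Metric.infDist_le_dist_of_mem hmem).trans (le_of_eq ?_)
    have hsub : x - (R / ‖x‖) • x = (1 - R / ‖x‖) • x := by rw [sub_smul, one_smul]
    have hnn : 0 ≤ 1 - R / ‖x‖ := sub_nonneg.2 ((div_le_one hpos).2 hx.le)
    rw [dist_eq_norm, hsub, norm_smul, Real.norm_eq_abs, abs_of_nonneg hnn]
    field_simp
  · refine (Metric.le_infDist ⟨0, by simpa using hR.le⟩).2 fun y hy => ?_
    have hy' : ‖y‖ ≤ R := hy
    rw [dist_eq_norm]
    linarith [norm_sub_norm_le x y]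

/-- The norm is `1 / r`-strongly quasiconvex on the ball of radius `r`. -/
theorem norm_convex_combination_le_max_sub {E : Type*} [NormedAddCommGroup E]
    [InnerProductSpace ℝ E] {r : ℝ} (hr : 0 < r) {x y : E} (hx : ‖x‖ ≤ r) (hy : ‖y‖ ≤ r)
    {l : ℝ} (hl₀ : 0 ≤ l) (hl₁ : l ≤ 1) :
    ‖(1 - l) • x + l • y‖ ≤ max ‖x‖ ‖y‖ - 1 / r / 2 * l * (1 - l) * ‖x - y‖ ^ 2 := by
  have hid := norm_sq_convex_combination x y l
  set M := max ‖x‖ ‖y‖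
  set N := ‖(1 - l) • x + l • y‖
  set t := l * (1 - l) * ‖x - y‖ ^ 2
  have ht : 0 ≤ t := mul_nonneg (mul_nonneg hl₀ (sub_nonneg.2 hl₁)) (sq_nonneg _)
  have hN : 0 ≤ N := norm_nonneg _
  have hM : 0 ≤ M := (norm_nonneg x).trans (le_max_left _ _)
  have hMr : M ≤ r := max_le hx hy
  have hxM : ‖x‖ ^ 2 ≤ M ^ 2 := pow_le_pow_left₀ (norm_nonneg _) (le_max_left _ _) 2
  have hyM : ‖y‖ ^ 2 ≤ M ^ 2 := pow_le_pow_left₀ (norm_nonneg _) (le_max_right _ _) 2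
  have hsq : N ^ 2 ≤ M ^ 2 - t := by
    nlinarith [mul_le_mul_of_nonneg_left hxM (sub_nonneg.2 hl₁),
      mul_le_mul_of_nonneg_left hyM hl₀]
  have hNM : N ≤ M := abs_le_of_sq_le_sq' (by linarith) hM |>.2
  have hdiff : t ≤ (M - N) * (2 * r) := by
    nlinarith [mul_le_mul_of_nonneg_left (show M + N ≤ 2 * r by linarith) (sub_nonneg.2 hNM)]
  have hdiv : t / (2 * r) ≤ M - N := (div_le_iff₀ (by positivity)).2 hdiff
  have heq : 1 / r / 2 * l * (1 - l) * ‖x - y‖ ^ 2 = t / (2 * r) := by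
    simp only [t]
    field_simp
  linarith

/-- Proposition 3.2 (second part): For the closed Euclidean ball `Ω` of radius
`R > 0` and `x₁, x₂` on the sphere of radius `r > R`, if the segment `[x₁, x₂]`
does not meet `Ω`, then the distance function `d_Ω` is `σ₁`-strongly
quasiconvex on `[x₁, x₂]` for some `σ₁ > 0`. -/
theorem distance_strong_quasiconvex_on_segment
    (n : ℕ) (R : ℝ) (hR : 0 < R) (r : ℝ) (hr : R < r)
    (x₁ x₂ : EuclideanSpace ℝ (Fin n)) (hx₁ : ‖x₁‖ = r) (hx₂ : ‖x₂‖ = r)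
    (hseg : segment ℝ x₁ x₂ ∩ {x : EuclideanSpace ℝ (Fin n) | ‖x‖ ≤ R} = ∅) :
    ∃ σ₁ > (0 : ℝ), ∀ y₁ ∈ segment ℝ x₁ x₂, ∀ y₂ ∈ segment ℝ x₁ x₂,
      ∀ l ∈ Set.Ioo (0 : ℝ) 1,
        Metric.infDist ((1 - l) • y₁ + l • y₂) {x : EuclideanSpace ℝ (Fin n) | ‖x‖ ≤ R} ≤
          max (Metric.infDist y₁ {x : EuclideanSpace ℝ (Fin n) | ‖x‖ ≤ R})
              (Metric.infDist y₂ {x : EuclideanSpace ℝ (Fin n) | ‖x‖ ≤ R}) -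
            σ₁ / 2 * l * (1 - l) * ‖y₁ - y₂‖ ^ 2 := by
  have hr₀ : 0 < r := hR.trans hr
  have hout : ∀ y ∈ segment ℝ x₁ x₂, R < ‖y‖ := fun y hy => by
    by_contra! h
    exact (Set.eq_empty_iff_forall_notMem.1 hseg) y ⟨hy, h⟩
  have hle : ∀ y ∈ segment ℝ x₁ x₂, ‖y‖ ≤ r := fun y hy => by
    have hsub := (convex_closedBall (0 : EuclideanSpace ℝ (Fin n)) r).segment_subset
      (mem_closedBall_zero_iff.2 hx₁.le) (mem_closedBall_zero_iff.2 hx₂.le)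
    exact mem_closedBall_zero_iff.1 (hsub hy)
  refine ⟨1 / r, one_div_pos.2 hr₀, fun y₁ hy₁ y₂ hy₂ l hl => ?_⟩
  have hz : (1 - l) • y₁ + l • y₂ ∈ segment ℝ x₁ x₂ :=
    convex_segment x₁ x₂ hy₁ hy₂ (sub_nonneg.2 hl.2.le) hl.1.le (by ring)
  rw [infDist_norm_le hR (hout _ hz), infDist_norm_le hR (hout _ hy₁),
    infDist_norm_le hR (hout _ hy₂), max_sub_sub_right]
  linarith [norm_convex_combination_le_max_sub hr₀ (hle _ hy₁) (hle _ hy₂) hl.1.le hl.2.le]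
end

section
/- Let 1 < p ≤ 2, equip ℝⁿ with the ℓp-norm, and let Ω = {x : ‖x‖ₚ ≤ R} with R > 0 be the closed ℓp-ball of radius R centered at the origin. Then for every point x₀ ∉ Ω there exist a bounded neighborhood U of x₀ with U ∩ Ω = ∅ and a constant σ > 0 such that the distance function d_Ω(x) = inf{‖x−y‖ₚ : y ∈ Ω} is σ-strongly quasiconvex on U. -/
/-- The `ℓp`-norm on `ℝⁿ`. -/
noncomputable def lpNorm (n : ℕ) (p : ℝ) (x : EuclideanSpace ℝ (Fin n)) : ℝ :=
  (∑ i, |x i| ^ p) ^ (1 / p)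

/-- The distance function to a set `Ω ⊆ ℝⁿ` with respect to the `ℓp`-norm. -/
noncomputable def lpDist (n : ℕ) (p : ℝ) (Ω : Set (EuclideanSpace ℝ (Fin n)))
    (x : EuclideanSpace ℝ (Fin n)) : ℝ :=
  sInf ((fun y => lpNorm n p (x - y)) '' Ω)

theorem hasDerivAt_rpow_sub_sq {p : ℝ} (hp : 1 ≤ p) (m t : ℝ) :
    HasDerivAt (fun t : ℝ => t ^ p - m / 2 * t ^ 2) (p * t ^ (p - 1) - m * t) t := by
  refine ((Real.hasDerivAt_rpow_const (x := t) (p := p) (Or.inr hp)).fun_sub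
    ((hasDerivAt_pow 2 t).const_mul (m / 2))).congr_deriv ?_
  norm_num
  ring

theorem monotoneOn_rpow_sub_sq {p B : ℝ} (hp1 : 1 < p) (hp2 : p ≤ 2) :
    MonotoneOn (fun t : ℝ => t ^ p - p * (p - 1) * B ^ (p - 2) / 2 * t ^ 2) (Set.Icc 0 B) := by
  refine monotoneOn_of_hasDerivWithinAt_nonneg
    (f' := fun t => p * t ^ (p - 1) - p * (p - 1) * B ^ (p - 2) * t) (convex_Icc 0 B) ?_ ?_ ?_
  · exact ((Real.continuous_rpow_const (by linarith)).sub (by fun_prop)).continuousOn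
  · exact fun t _ => (hasDerivAt_rpow_sub_sq hp1.le _ t).hasDerivWithinAt
  · intro t ht
    rw [interior_Icc] at ht
    have hB : B ^ (p - 2) ≤ t ^ (p - 2) :=
      Real.rpow_le_rpow_of_nonpos ht.1 ht.2.le (by linarith)
    have hB0 : 0 < B ^ (p - 2) := Real.rpow_pos_of_pos (ht.1.trans ht.2) _
    have hsplit : t ^ (p - 1) = t ^ (p - 2) * t := by
      rw [← Real.rpow_add_one ht.1.ne']
      ring_nf
    have h : (p - 1) * B ^ (p - 2) ≤ t ^ (p - 2) := by nlinarith
    have := mul_le_mul_of_nonneg_left h (mul_nonneg (by linarith : 0 ≤ p) ht.1.le)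
    simp only [hsplit]
    linarith

theorem convexOn_rpow_sub_sq {p B : ℝ} (hp1 : 1 < p) (hp2 : p ≤ 2) :
    ConvexOn ℝ (Set.Icc 0 B)
      (fun t : ℝ => t ^ p - p * (p - 1) * B ^ (p - 2) / 2 * t ^ 2) := by
  refine convexOn_of_hasDerivWithinAt2_nonneg
    (f' := fun t => p * t ^ (p - 1) - p * (p - 1) * B ^ (p - 2) * t)
    (f'' := fun t => p * ((p - 1) * t ^ (p - 2)) - p * (p - 1) * B ^ (p - 2))
    (convex_Icc 0 B) ?_ ?_ ?_ ?_
  · exact ((Real.continuous_rpow_const (by linarith)).sub (by fun_prop)).continuousOn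
  · exact fun t _ => (hasDerivAt_rpow_sub_sq hp1.le _ t).hasDerivWithinAt
  · intro t ht
    rw [interior_Icc] at ht
    refine HasDerivAt.hasDerivWithinAt ?_
    refine (((Real.hasDerivAt_rpow_const (x := t) (p := p - 1)
      (Or.inl ht.1.ne')).const_mul p).fun_sub
      ((hasDerivAt_id t).const_mul (p * (p - 1) * B ^ (p - 2)))).congr_deriv ?_
    ring_nf
  · intro t ht
    rw [interior_Icc] at ht
    have hB : B ^ (p - 2) ≤ t ^ (p - 2) :=
      Real.rpow_le_rpow_of_nonpos ht.1 ht.2.le (by linarith)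
    have := mul_le_mul_of_nonneg_left hB (mul_nonneg (by linarith : 0 ≤ p) (sub_nonneg.2 hp1.le))
    linarith

/-- Strong convexity of `|t| ^ p` on `[-B, B]` for `1 < p ≤ 2`. -/
theorem abs_rpow_strong_convex {p B : ℝ} (hp1 : 1 < p) (hp2 : p ≤ 2) {x y l : ℝ}
    (hx : |x| ≤ B) (hy : |y| ≤ B) (hl : l ∈ Set.Ioo (0 : ℝ) 1) :
    |l * x + (1 - l) * y| ^ p ≤ l * |x| ^ p + (1 - l) * |y| ^ p -
      p * (p - 1) * B ^ (p - 2) / 2 * (l * (1 - l) * (x - y) ^ 2) := by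
  have hl0 := hl.1
  have hl1 : 0 < 1 - l := sub_pos.2 hl.2
  have hxm : |x| ∈ Set.Icc 0 B := ⟨abs_nonneg x, hx⟩
  have hym : |y| ∈ Set.Icc 0 B := ⟨abs_nonneg y, hy⟩
  have habs : |l * x + (1 - l) * y| ≤ l * |x| + (1 - l) * |y| :=
    (abs_add_le _ _).trans_eq (by rw [abs_mul, abs_mul, abs_of_pos hl0, abs_of_pos hl1])
  have hcomb : l * |x| + (1 - l) * |y| ∈ Set.Icc 0 B :=
    convex_Icc 0 B hxm hym hl0.le hl1.le (by ring)
  have hmono := monotoneOn_rpow_sub_sq hp1 hp2 ⟨abs_nonneg _, habs.trans hcomb.2⟩ hcomb habs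
  have hconv := (convexOn_rpow_sub_sq (B := B) hp1 hp2).2 hxm hym hl0.le hl1.le (by ring)
  simp only [smul_eq_mul, sq_abs] at hmono hconv
  linarith [hmono.trans hconv]

theorem sum_abs_rpow_strong_convex {n : ℕ} {p B : ℝ} (hp1 : 1 < p) (hp2 : p ≤ 2)
    {x y : EuclideanSpace ℝ (Fin n)} (hx : ‖x‖ ≤ B) (hy : ‖y‖ ≤ B) {l : ℝ}
    (hl : l ∈ Set.Ioo (0 : ℝ) 1) :
    ∑ i, |(l • x + (1 - l) • y) i| ^ p ≤
      l * ∑ i, |x i| ^ p + (1 - l) * ∑ i, |y i| ^ p -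
        p * (p - 1) * B ^ (p - 2) / 2 * (l * (1 - l) * ‖x - y‖ ^ 2) := by
  rw [EuclideanSpace.real_norm_sq_eq]
  simp only [Finset.mul_sum]
  rw [← Finset.sum_add_distrib, ← Finset.sum_sub_distrib]
  refine Finset.sum_le_sum fun i _ => ?_
  have h (z : EuclideanSpace ℝ (Fin n)) : |z i| ≤ ‖z‖ := PiLp.norm_apply_le z i
  simpa using abs_rpow_strong_convex hp1 hp2 ((h x).trans hx) ((h y).trans hy) hl

theorem lpNorm_nonneg (n : ℕ) (p : ℝ) (x : EuclideanSpace ℝ (Fin n)) : 0 ≤ lpNorm n p x :=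
  Real.rpow_nonneg (Finset.sum_nonneg fun _ _ => Real.rpow_nonneg (abs_nonneg _) _) _

theorem lpNorm_rpow {n : ℕ} {p : ℝ} (hp : 0 < p) (x : EuclideanSpace ℝ (Fin n)) :
    lpNorm n p x ^ p = ∑ i, |x i| ^ p := by
  rw [lpNorm, ← Real.rpow_mul (Finset.sum_nonneg fun _ _ => Real.rpow_nonneg (abs_nonneg _) _),
    one_div_mul_cancel hp.ne', Real.rpow_one]

theorem continuous_lpNorm {n : ℕ} {p : ℝ} (hp : 0 < p) : Continuous (lpNorm n p) := by
  refine Continuous.rpow_const (continuous_finsetSum _ fun i _ => ?_)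
    fun _ => Or.inr (by positivity)
  exact Continuous.rpow_const (by fun_prop) fun _ => Or.inr hp.le

theorem lpNorm_add_le {n : ℕ} {p : ℝ} (hp : 1 ≤ p) (x y : EuclideanSpace ℝ (Fin n)) :
    lpNorm n p (x + y) ≤ lpNorm n p x + lpNorm n p y :=
  Real.Lp_add_le Finset.univ x y hp

theorem lpNorm_smul {n : ℕ} {p : ℝ} (hp : 0 < p) {c : ℝ} (hc : 0 ≤ c)
    (x : EuclideanSpace ℝ (Fin n)) : lpNorm n p (c • x) = c * lpNorm n p x := by
  rw [← Real.rpow_left_inj (lpNorm_nonneg n p _) (mul_nonneg hc (lpNorm_nonneg n p x)) hp.ne',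
    Real.mul_rpow hc (lpNorm_nonneg n p x), lpNorm_rpow hp, lpNorm_rpow hp, Finset.mul_sum]
  exact Finset.sum_congr rfl fun i _ => by
    simp [abs_mul, abs_of_nonneg hc, Real.mul_rpow hc (abs_nonneg _)]

/-- Outside the closed `ℓp`-ball of radius `R`, the distance to the ball is `‖x‖ₚ - R`. -/
theorem lpDist_closedBall {n : ℕ} {p R : ℝ} (hp : 1 ≤ p) (hR : 0 < R)
    {x : EuclideanSpace ℝ (Fin n)} (hx : R ≤ lpNorm n p x) :
    lpDist n p {x : EuclideanSpace ℝ (Fin n) | lpNorm n p x ≤ R} x = lpNorm n p x - R := by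
  have hp0 : 0 < p := by linarith
  have hx0 : 0 < lpNorm n p x := hR.trans_le hx
  refine IsLeast.csInf_eq ⟨⟨(R / lpNorm n p x) • x, ?_, ?_⟩, ?_⟩
  · rw [Set.mem_ofPred_eq, lpNorm_smul hp0 (by positivity), div_mul_cancel₀ _ hx0.ne']
  · have hc : 0 ≤ 1 - R / lpNorm n p x := sub_nonneg.2 ((div_le_one hx0).2 hx)
    have hsub : x - (R / lpNorm n p x) • x = (1 - R / lpNorm n p x) • x := by
      rw [sub_smul, one_smul]
    simp only [hsub]
    rw [lpNorm_smul hp0 hc, sub_mul, one_mul, div_mul_cancel₀ _ hx0.ne']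
  · rintro _ ⟨y, hy, rfl⟩
    have h := lpNorm_add_le hp (x - y) y
    rw [sub_add_cancel] at h
    have hy' : lpNorm n p y ≤ R := hy
    simp only
    linarith

theorem rpow_sub_rpow_le_s8 {p s t : ℝ} (hp : 1 ≤ p) (hs : 0 ≤ s) (ht : 0 < t) :
    t ^ p - s ^ p ≤ p * t ^ (p - 1) * (t - s) := by
  have h := one_add_mul_self_le_rpow_one_add (s := s / t - 1)
    (by linarith [div_nonneg hs ht.le]) hp
  rw [add_sub_cancel, Real.div_rpow hs ht.le, le_div_iff₀ (Real.rpow_pos_of_pos ht p)] at h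
  have hsplit : t ^ p = t ^ (p - 1) * t := by
    rw [← Real.rpow_add_one ht.ne', sub_add_cancel]
  have hcalc : (1 + p * (s / t - 1)) * t ^ p = t ^ p - p * t ^ (p - 1) * (t - s) := by
    rw [hsplit]
    field_simp
    ring
  linarith

/-- Strong quasiconvexity of the `ℓp`-norm, with modulus depending on bounds for the
Euclidean norms and the `ℓp`-norms of the two points. -/
theorem lpNorm_strong_quasiconvex {n : ℕ} {p B K : ℝ} (hp1 : 1 < p) (hp2 : p ≤ 2) (hB : 0 < B)
    {x y : EuclideanSpace ℝ (Fin n)} (hx : ‖x‖ ≤ B) (hy : ‖y‖ ≤ B)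
    (hxK : lpNorm n p x ≤ K) (hyK : lpNorm n p y ≤ K)
    (hpos : 0 < max (lpNorm n p x) (lpNorm n p y)) {l : ℝ} (hl : l ∈ Set.Ioo (0 : ℝ) 1) :
    lpNorm n p (l • x + (1 - l) • y) ≤ max (lpNorm n p x) (lpNorm n p y) -
      ((p - 1) * B ^ (p - 2) / K ^ (p - 1)) / 2 * l * (1 - l) * ‖x - y‖ ^ 2 := by
  have hp0 : 0 < p := by linarith
  have hl0 := hl.1
  have hl1 : 0 < 1 - l := sub_pos.2 hl.2
  set S := max (lpNorm n p x) (lpNorm n p y)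
  set s := lpNorm n p (l • x + (1 - l) • y) with hs
  have hSK : S ≤ K := max_le hxK hyK
  have hsum := sum_abs_rpow_strong_convex hp1 hp2 hx hy hl
  rw [← lpNorm_rpow hp0, ← lpNorm_rpow hp0, ← lpNorm_rpow hp0, ← hs] at hsum
  have hxS : lpNorm n p x ^ p ≤ S ^ p :=
    Real.rpow_le_rpow (lpNorm_nonneg n p x) (le_max_left _ _) hp0.le
  have hyS : lpNorm n p y ^ p ≤ S ^ p :=
    Real.rpow_le_rpow (lpNorm_nonneg n p y) (le_max_right _ _) hp0.le
  have hbern := rpow_sub_rpow_le_s8 hp1.le (lpNorm_nonneg n p (l • x + (1 - l) • y)) hpos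
  rw [← hs] at hbern
  set A := (p - 1) * B ^ (p - 2) / 2 * (l * (1 - l) * ‖x - y‖ ^ 2) with hA
  have hA0 : 0 ≤ A := by
    have := sub_pos.2 hp1
    positivity
  have hAS : p * A ≤ p * (S ^ (p - 1) * (S - s)) := by
    have h1 := mul_le_mul_of_nonneg_left hxS hl0.le
    have h2 := mul_le_mul_of_nonneg_left hyS hl1.le
    rw [hA]
    linarith
  have hAS' : A ≤ S ^ (p - 1) * (S - s) := le_of_mul_le_mul_left hAS hp0
  have hSs : 0 ≤ S - s :=
    nonneg_of_mul_nonneg_right (hA0.trans hAS') (Real.rpow_pos_of_pos hpos _)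
  have hK : 0 < K ^ (p - 1) := Real.rpow_pos_of_pos (hpos.trans_le hSK) _
  have hAK : A ≤ (S - s) * K ^ (p - 1) := by
    have := mul_le_mul_of_nonneg_right
      (Real.rpow_le_rpow hpos.le hSK (sub_nonneg.2 hp1.le)) hSs
    linarith
  have hfin := (div_le_iff₀ hK).2 hAK
  have heq : A / K ^ (p - 1) =
      ((p - 1) * B ^ (p - 2) / K ^ (p - 1)) / 2 * l * (1 - l) * ‖x - y‖ ^ 2 := by
    rw [hA]
    ring
  linarith

/-- Theorem 3.5: For `1 < p ≤ 2` and `Ω` the closed `ℓp`-ball of radius `R > 0`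
centered at the origin, every point `x₀ ∉ Ω` admits a bounded (convex)
neighborhood `U` disjoint from `Ω` on which the `ℓp`-distance function `d_Ω`
is `σ`-strongly quasiconvex (with Euclidean penalty term) for some `σ > 0`. -/
theorem lp_distance_locally_strong_quasiconvex
    (n : ℕ) (p : ℝ) (hp1 : 1 < p) (hp2 : p ≤ 2) (R : ℝ) (hR : 0 < R)
    (x₀ : EuclideanSpace ℝ (Fin n))
    (hx₀ : x₀ ∉ {x : EuclideanSpace ℝ (Fin n) | lpNorm n p x ≤ R}) :
    ∃ U : Set (EuclideanSpace ℝ (Fin n)),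
      U ∈ nhds x₀ ∧ Bornology.IsBounded U ∧ Convex ℝ U ∧
      U ∩ {x : EuclideanSpace ℝ (Fin n) | lpNorm n p x ≤ R} = ∅ ∧
      ∃ σ > (0 : ℝ), ∀ x ∈ U, ∀ y ∈ U, ∀ l ∈ Set.Ioo (0 : ℝ) 1,
        lpDist n p {x : EuclideanSpace ℝ (Fin n) | lpNorm n p x ≤ R}
            (l • x + (1 - l) • y) ≤
          max (lpDist n p {x : EuclideanSpace ℝ (Fin n) | lpNorm n p x ≤ R} x)
              (lpDist n p {x : EuclideanSpace ℝ (Fin n) | lpNorm n p x ≤ R} y) -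
            σ / 2 * l * (1 - l) * ‖x - y‖ ^ 2 := by
  have hp0 : 0 < p := by linarith
  have hcont := continuous_lpNorm (n := n) hp0
  have hx₀' : R < lpNorm n p x₀ := not_le.1 hx₀
  set K := lpNorm n p x₀ + 1 with hK
  have hnhds : {x | R < lpNorm n p x ∧ lpNorm n p x < K} ∈ nhds x₀ :=
    ((isOpen_lt continuous_const hcont).inter (isOpen_lt hcont continuous_const)).mem_nhds
      ⟨hx₀', lt_add_one (lpNorm n p x₀)⟩
  obtain ⟨r, hr, hball⟩ := Metric.mem_nhds_iff.1 hnhds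
  have hB : 0 < ‖x₀‖ + r := by positivity
  have hK0 : 0 < K := by linarith
  have hnorm : ∀ x ∈ Metric.ball x₀ r, ‖x‖ ≤ ‖x₀‖ + r := fun x hx =>
    (norm_lt_of_mem_ball hx).le
  refine ⟨Metric.ball x₀ r, Metric.ball_mem_nhds x₀ hr, Metric.isBounded_ball,
    convex_ball x₀ r, ?_, (p - 1) * (‖x₀‖ + r) ^ (p - 2) / K ^ (p - 1), ?_, ?_⟩
  · exact Set.eq_empty_of_forall_notMem fun x hx => (hball hx.1).1.not_ge hx.2
  · have := sub_pos.2 hp1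
    positivity
  · intro x hx y hy l hl
    have hz : l • x + (1 - l) • y ∈ Metric.ball x₀ r :=
      convex_ball x₀ r hx hy hl.1.le (sub_nonneg.2 hl.2.le) (by ring)
    rw [lpDist_closedBall hp1.le hR (hball hx).1.le, lpDist_closedBall hp1.le hR (hball hy).1.le,
      lpDist_closedBall hp1.le hR (hball hz).1.le, max_sub_sub_right]
    have h := lpNorm_strong_quasiconvex hp1 hp2 hB (hnorm x hx) (hnorm y hy)
      (hball hx).2.le (hball hy).2.le (lt_max_of_lt_left (hR.trans (hball hx).1)) hl
    linarith
end

section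
/- In Euclidean ℝⁿ, let Ω be a nonempty compact set that is strongly convex with respect to R > 0, and let r > 0 be such that the sphere S = {x : ‖x‖₂ = r} satisfies S ∩ Ω = ∅. Suppose there exists a constant c₀ > 0 such that for all x₁, x₂ ∈ S, ‖p₁ − p₂‖₂ ≥ c₀‖x₁ − x₂‖₂, where pᵢ denotes the Euclidean projection of xᵢ onto Ω. Then there exists σ > 0 such that for all x₁, x₂ ∈ S and all λ ∈ (0,1), d_Ω((1−λ)x₁ + λx₂) ≤ max{d_Ω(x₁), d_Ω(x₂)} − (σ/2)λ(1−λ)‖x₁−x₂‖₂². -/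
/-- `D_R(x, y)`: the intersection of all closed Euclidean balls of radius `R`
containing both `x` and `y`. -/
def ballIntersection {n : ℕ} (R : ℝ) (x y : EuclideanSpace ℝ (Fin n)) :
    Set (EuclideanSpace ℝ (Fin n)) :=
  ⋂ c ∈ {c : EuclideanSpace ℝ (Fin n) |
      x ∈ Metric.closedBall c R ∧ y ∈ Metric.closedBall c R}, Metric.closedBall c R

/-- A nonempty bounded set `Ω` is strongly convex with respect to `R > 0` if
`D_R(x, y) ⊆ Ω` for all `x, y ∈ Ω`. -/
def StronglyConvexWith {n : ℕ} (R : ℝ) (Ω : Set (EuclideanSpace ℝ (Fin n))) : Prop :=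
  ∀ x ∈ Ω, ∀ y ∈ Ω, ballIntersection R x y ⊆ Ω

theorem norm_convex_combination_sq {E : Type*} [NormedAddCommGroup E] [InnerProductSpace ℝ E]
    (a b : E) (l : ℝ) :
    ‖(1 - l) • a + l • b‖ ^ 2 =
      (1 - l) * ‖a‖ ^ 2 + l * ‖b‖ ^ 2 - l * (1 - l) * ‖a - b‖ ^ 2 := by
  rw [norm_add_sq_real, norm_sub_sq_real, norm_smul, norm_smul, mul_pow, mul_pow,
    Real.norm_eq_abs, Real.norm_eq_abs, sq_abs, sq_abs, real_inner_smul_left,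
    real_inner_smul_right]
  ring

theorem closedBall_subset_ballIntersection {n : ℕ} {R : ℝ} (hR : 0 < R)
    (x y : EuclideanSpace ℝ (Fin n)) {l : ℝ} (h0 : 0 ≤ l) (h1 : l ≤ 1) :
    Metric.closedBall ((1 - l) • x + l • y) (l * (1 - l) * ‖x - y‖ ^ 2 / (2 * R)) ⊆
      ballIntersection R x y := by
  intro z hz
  simp only [ballIntersection, Set.mem_iInter, Set.mem_ofPred_eq, Metric.mem_closedBall]
    at hz ⊢
  rintro c ⟨hx, hy⟩
  rw [dist_eq_norm] at hx hy
  set δ := l * (1 - l) * ‖x - y‖ ^ 2 / (2 * R) with hδ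
  have hδR : l * (1 - l) * ‖x - y‖ ^ 2 = 2 * R * δ := by rw [hδ]; field_simp
  have hxy := norm_convex_combination_sq (x - c) (y - c) l
  rw [sub_sub_sub_cancel_right, hδR,
    show (1 - l) • (x - c) + l • (y - c) = (1 - l) • x + l • y - c by module] at hxy
  have hx2 : ‖x - c‖ ^ 2 ≤ R ^ 2 := pow_le_pow_left₀ (norm_nonneg _) hx 2
  have hy2 : ‖y - c‖ ^ 2 ≤ R ^ 2 := pow_le_pow_left₀ (norm_nonneg _) hy 2
  have hsq : ‖(1 - l) • x + l • y - c‖ ^ 2 ≤ R ^ 2 - 2 * R * δ := by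
    nlinarith [mul_le_mul_of_nonneg_left hx2 (sub_nonneg.2 h1),
      mul_le_mul_of_nonneg_left hy2 h0]
  have hδle : 0 ≤ R - δ := by
    have := sq_nonneg ‖(1 - l) • x + l • y - c‖
    by_contra! h
    nlinarith
  have hq : ‖(1 - l) • x + l • y - c‖ ≤ R - δ :=
    le_of_sq_le_sq (by nlinarith [sq_nonneg δ]) hδle
  rw [← dist_eq_norm] at hq
  linarith [dist_triangle z ((1 - l) • x + l • y) c]

theorem infDist_le_max_dist_sub_of_closedBall_subset {E : Type*} [NormedAddCommGroup E]
    [NormedSpace ℝ E] {s : Set E} {q : E} {δ : ℝ} (hδ : 0 ≤ δ)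
    (hs : Metric.closedBall q δ ⊆ s) (z : E) :
    Metric.infDist z s ≤ max 0 (dist z q - δ) := by
  rcases le_total (dist z q) δ with h | h
  · rw [Metric.infDist_zero_of_mem (hs h)]
    exact le_max_left _ _
  · refine le_max_of_le_right ?_
    rcases (dist_nonneg (x := z) (y := q)).eq_or_lt with h0 | hpos
    · rw [Metric.infDist_zero_of_mem (hs (h0 ▸ hδ : dist z q ≤ δ))]
      linarith
    · have hmem : AffineMap.lineMap q z (δ / dist z q) ∈ s := by
        apply hs
        rw [Metric.mem_closedBall, dist_lineMap_left, Real.norm_of_nonneg (by positivity),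
          dist_comm q z, div_mul_cancel₀ _ hpos.ne']
      refine (Metric.infDist_le_dist_of_mem hmem).trans_eq ?_
      rw [dist_comm, dist_lineMap_right, dist_comm q z, Real.norm_of_nonneg
        (sub_nonneg.2 ((div_le_one hpos).2 h)), sub_mul, div_mul_cancel₀ _ hpos.ne', one_mul]

theorem exists_pos_le_infDist_of_disjoint {E : Type*} [PseudoMetricSpace E] {K s : Set E}
    (hK : IsCompact K) (hs : IsClosed s) (hne : s.Nonempty) (hd : K ∩ s = ∅) :
    ∃ m > 0, ∀ x ∈ K, m ≤ Metric.infDist x s := by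
  rcases K.eq_empty_or_nonempty with rfl | hKne
  · exact ⟨1, one_pos, by simp⟩
  · obtain ⟨x, hx, hmin⟩ :=
      hK.exists_isMinOn hKne (Metric.continuous_infDist_pt s).continuousOn
    refine ⟨_, (hs.notMem_iff_infDist_pos hne).1 fun hxs => ?_, fun y hy => hmin hy⟩
    exact (hd.subset ⟨hx, hxs⟩ : x ∈ (∅ : Set E))

/-- Theorem 3.9: Let `Ω ⊆ ℝⁿ` be a nonempty compact set, strongly convex with
respect to `R > 0`, and let `r > 0` be such that the sphere of radius `r` does
not meet `Ω`. If the Euclidean projections onto `Ω` of points of the sphere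
satisfy `‖p₁ - p₂‖ ≥ c₀ ‖x₁ - x₂‖` for some `c₀ > 0`, then there is `σ > 0`
such that the strong quasiconvexity inequality for `d_Ω` holds along chords
joining points of the sphere. -/
theorem distance_strong_quasiconvex_strongly_convex_set
    (n : ℕ) (R : ℝ) (hR : 0 < R)
    (Ω : Set (EuclideanSpace ℝ (Fin n))) (hΩne : Ω.Nonempty) (hΩcomp : IsCompact Ω)
    (hΩsc : StronglyConvexWith R Ω)
    (r : ℝ) (hr : 0 < r)
    (hSdisj : {x : EuclideanSpace ℝ (Fin n) | ‖x‖ = r} ∩ Ω = ∅)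
    (c₀ : ℝ) (hc₀ : 0 < c₀)
    (hproj : ∀ x₁ x₂ : EuclideanSpace ℝ (Fin n), ‖x₁‖ = r → ‖x₂‖ = r →
      ∀ p₁ ∈ Ω, ∀ p₂ ∈ Ω,
        dist x₁ p₁ = Metric.infDist x₁ Ω → dist x₂ p₂ = Metric.infDist x₂ Ω →
          ‖p₁ - p₂‖ ≥ c₀ * ‖x₁ - x₂‖) :
    ∃ σ > (0 : ℝ), ∀ x₁ x₂ : EuclideanSpace ℝ (Fin n),
      ‖x₁‖ = r → ‖x₂‖ = r → ∀ l ∈ Set.Ioo (0 : ℝ) 1,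
        Metric.infDist ((1 - l) • x₁ + l • x₂) Ω ≤
          max (Metric.infDist x₁ Ω) (Metric.infDist x₂ Ω) -
            σ / 2 * l * (1 - l) * ‖x₁ - x₂‖ ^ 2 := by
  obtain ⟨m, hm, hmle⟩ := exists_pos_le_infDist_of_disjoint
    (K := {x : EuclideanSpace ℝ (Fin n) | ‖x‖ = r})
    (by convert isCompact_sphere (0 : EuclideanSpace ℝ (Fin n)) r; ext; simp)
    hΩcomp.isClosed hΩne hSdisj
  refine ⟨min (c₀ ^ 2 / R) (2 * m / r ^ 2), by positivity, fun x₁ x₂ h₁ h₂ l ⟨hl0, hl1⟩ => ?_⟩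
  obtain ⟨p₁, hp₁, e₁⟩ := hΩcomp.exists_infDist_eq_dist hΩne x₁
  obtain ⟨p₂, hp₂, e₂⟩ := hΩcomp.exists_infDist_eq_dist hΩne x₂
  have hp := hproj x₁ x₂ h₁ h₂ p₁ hp₁ p₂ hp₂ e₁.symm e₂.symm
  have hl : 0 < l * (1 - l) := mul_pos hl0 (sub_pos.2 hl1)
  set σ := min (c₀ ^ 2 / R) (2 * m / r ^ 2)
  have hσ : 0 < σ := by positivity
  have hball := (closedBall_subset_ballIntersection hR p₁ p₂ hl0.le hl1.le).trans
    (hΩsc p₁ hp₁ p₂ hp₂)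
  have hmain := infDist_le_max_dist_sub_of_closedBall_subset (by positivity) hball
    ((1 - l) • x₁ + l • x₂)
  refine hmain.trans (max_le ?_ ?_)
  · have hmax : m ≤ max (Metric.infDist x₁ Ω) (Metric.infDist x₂ Ω) :=
      (hmle x₁ h₁).trans (le_max_left _ _)
    have hnorm : ‖x₁ - x₂‖ ^ 2 ≤ (2 * r) ^ 2 :=
      pow_le_pow_left₀ (norm_nonneg _) (by linarith [norm_sub_le x₁ x₂]) 2
    have hσm : σ * r ^ 2 ≤ 2 * m :=
      (le_div_iff₀ (by positivity)).1 (min_le_right _ _)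
    have hl4 : l * (1 - l) ≤ 1 / 4 := by nlinarith [sq_nonneg (l - 1 / 2)]
    have : l * (1 - l) * ‖x₁ - x₂‖ ^ 2 ≤ 1 / 4 * (2 * r) ^ 2 := by gcongr
    nlinarith [mul_le_mul_of_nonneg_left this hσ.le]
  · have hdist : dist ((1 - l) • x₁ + l • x₂) ((1 - l) • p₁ + l • p₂) ≤
        max (Metric.infDist x₁ Ω) (Metric.infDist x₂ Ω) := by
      refine (dist_add_add_le _ _ _ _).trans ?_
      rw [dist_smul₀, dist_smul₀, Real.norm_of_nonneg (sub_nonneg.2 hl1.le),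
        Real.norm_of_nonneg hl0.le, ← e₁, ← e₂]
      nlinarith [le_max_left (Metric.infDist x₁ Ω) (Metric.infDist x₂ Ω),
        le_max_right (Metric.infDist x₁ Ω) (Metric.infDist x₂ Ω)]
    have hsq : (c₀ * ‖x₁ - x₂‖) ^ 2 ≤ ‖p₁ - p₂‖ ^ 2 :=
      pow_le_pow_left₀ (by positivity) hp 2
    have hgap : σ / 2 * l * (1 - l) * ‖x₁ - x₂‖ ^ 2 ≤
        l * (1 - l) * ‖p₁ - p₂‖ ^ 2 / (2 * R) := by
      calc σ / 2 * l * (1 - l) * ‖x₁ - x₂‖ ^ 2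
          = σ * (l * (1 - l) * ‖x₁ - x₂‖ ^ 2 / 2) := by ring
        _ ≤ c₀ ^ 2 / R * (l * (1 - l) * ‖x₁ - x₂‖ ^ 2 / 2) := by
          gcongr
          exact min_le_left _ _
        _ = l * (1 - l) * (c₀ * ‖x₁ - x₂‖) ^ 2 / (2 * R) := by field_simp
        _ ≤ _ := by gcongr
    linarith
end

section
/- Let C ⊆ ℝⁿ be a nonempty convex set, let f : ℝⁿ → ℝ be continuous, and let σ > 0. If f is σ-strongly quasiconvex on C, then f is σ-strongly quasiconvex on the closure of C. -/
/-- If a continuous function `f : ℝⁿ → ℝ` is `σ`-strongly quasiconvex on a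
nonempty convex set `C`, then it is `σ`-strongly quasiconvex on the closure
of `C`. -/
theorem strong_quasiconvex_closure
    (n : ℕ) (C : Set (EuclideanSpace ℝ (Fin n)))
    (hCne : C.Nonempty) (hCconv : Convex ℝ C)
    (f : EuclideanSpace ℝ (Fin n) → ℝ) (hf : Continuous f)
    (σ : ℝ) (hσ : 0 < σ)
    (hsq : ∀ x ∈ C, ∀ y ∈ C, ∀ l ∈ Set.Ioo (0 : ℝ) 1,
      f (l • x + (1 - l) • y) ≤
        max (f x) (f y) - σ / 2 * l * (1 - l) * ‖x - y‖ ^ 2) :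
    ∀ x ∈ closure C, ∀ y ∈ closure C, ∀ l ∈ Set.Ioo (0 : ℝ) 1,
      f (l • x + (1 - l) • y) ≤
        max (f x) (f y) - σ / 2 * l * (1 - l) * ‖x - y‖ ^ 2 := by
  intro x hx y hy l hl
  have hclosed : IsClosed {p : EuclideanSpace ℝ (Fin n) × EuclideanSpace ℝ (Fin n) |
      f (l • p.1 + (1 - l) • p.2) ≤
        max (f p.1) (f p.2) - σ / 2 * l * (1 - l) * ‖p.1 - p.2‖ ^ 2} :=
    isClosed_le (by fun_prop) (by fun_prop)
  have hxy : (x, y) ∈ closure (C ×ˢ C) := by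
    rw [closure_prod_eq]
    exact ⟨hx, hy⟩
  exact closure_minimal (fun p hp => hsq p.1 hp.1 p.2 hp.2 l hl) hclosed hxy
end

section
/- In Euclidean ℝ², let Ω = {(u,v) : u ≤ 0} and let U = {(u,v) : 1/2 < u ≤ 2, −2 ≤ v ≤ 2}. Then U ∩ Ω = ∅, and for every σ > 0 the distance function d_Ω (with respect to the Euclidean norm) is not σ-strongly quasiconvex on U. -/
/-- The distance from a point with nonnegative first coordinate to the left half-plane is that
coordinate. -/
theorem infDist_leftHalfPlane {x : EuclideanSpace ℝ (Fin 2)} (hx : 0 ≤ x 0) :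
    Metric.infDist x {y : EuclideanSpace ℝ (Fin 2) | y 0 ≤ 0} = x 0 := by
  apply le_antisymm
  · have hmem : !₂[(0 : ℝ), x 1] ∈ {y : EuclideanSpace ℝ (Fin 2) | y 0 ≤ 0} := by simp
    refine (Metric.infDist_le_dist_of_mem hmem).trans_eq ?_
    simp [EuclideanSpace.dist_eq, Fin.sum_univ_two, Real.dist_eq, hx]
  · refine (Metric.le_infDist ⟨0, by simp⟩).2 fun y hy => ?_
    have hle := PiLp.norm_apply_le (x - y) 0
    rw [Set.mem_ofPred_eq] at hy
    rw [PiLp.sub_apply, Real.norm_eq_abs] at hle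
    rw [dist_eq_norm]
    linarith [le_abs_self (x 0 - y 0)]

/-- Example 3.1: In Euclidean `ℝ²`, for `Ω = {(u,v) : u ≤ 0}` and
`U = {(u,v) : 1/2 < u ≤ 2, -2 ≤ v ≤ 2}`, we have `U ∩ Ω = ∅` and the Euclidean
distance function `d_Ω` is not `σ`-strongly quasiconvex on `U` for any `σ > 0`. -/
theorem distance_to_halfplane_not_strongly_quasiconvex :
    ({x : EuclideanSpace ℝ (Fin 2) | 1 / 2 < x 0 ∧ x 0 ≤ 2 ∧ -2 ≤ x 1 ∧ x 1 ≤ 2} ∩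
      {x : EuclideanSpace ℝ (Fin 2) | x 0 ≤ 0} = ∅) ∧
    ∀ σ > (0 : ℝ),
      ¬ (∀ x ∈ {x : EuclideanSpace ℝ (Fin 2) | 1 / 2 < x 0 ∧ x 0 ≤ 2 ∧ -2 ≤ x 1 ∧ x 1 ≤ 2},
          ∀ y ∈ {x : EuclideanSpace ℝ (Fin 2) | 1 / 2 < x 0 ∧ x 0 ≤ 2 ∧ -2 ≤ x 1 ∧ x 1 ≤ 2},
          ∀ l ∈ Set.Ioo (0 : ℝ) 1,
            Metric.infDist (l • x + (1 - l) • y) {x : EuclideanSpace ℝ (Fin 2) | x 0 ≤ 0} ≤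
              max (Metric.infDist x {x : EuclideanSpace ℝ (Fin 2) | x 0 ≤ 0})
                  (Metric.infDist y {x : EuclideanSpace ℝ (Fin 2) | x 0 ≤ 0}) -
                σ / 2 * l * (1 - l) * ‖x - y‖ ^ 2) := by
  constructor
  · ext x
    simp only [Set.mem_inter_iff, Set.mem_ofPred_eq, Set.mem_empty_iff_false, iff_false]
    rintro ⟨⟨h, -⟩, h'⟩
    linarith
  · intro σ hσ h
    have key := h !₂[1, 0] (by norm_num) !₂[1, 1] (by norm_num) (1 / 2) (by norm_num)
    rw [infDist_leftHalfPlane (by norm_num), infDist_leftHalfPlane (by norm_num),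
      infDist_leftHalfPlane (by norm_num), EuclideanSpace.norm_sq_eq] at key
    norm_num [Fin.sum_univ_two] at key
    linarith
end

section
/- Equip ℝ² with the maximum norm ‖(u,v)‖_∞ = max{|u|,|v|}, and let Ω = {x : ‖x‖_∞ ≤ 1/2} = [−1/2,1/2]². Let x₁ = (2,0) and x₂ = (2,1), which both lie on the sphere {x : ‖x‖_∞ = 2}. Then there is no constant σ > 0 such that d_Ω((1−λ)x₁ + λx₂) ≤ max{d_Ω(x₁), d_Ω(x₂)} − (σ/2)λ(1−λ)‖x₁−x₂‖₂² for all λ ∈ (0,1), where d_Ω(x) = inf{‖x−y‖_∞ : y ∈ Ω}. -/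
/-- The maximum norm on `ℝ²` (viewed as the Euclidean plane). -/
noncomputable def maxNorm (x : EuclideanSpace ℝ (Fin 2)) : ℝ := max |x 0| |x 1|

/-- The distance function to a set `Ω ⊆ ℝ²` with respect to the maximum norm. -/
noncomputable def maxDist (Ω : Set (EuclideanSpace ℝ (Fin 2)))
    (x : EuclideanSpace ℝ (Fin 2)) : ℝ :=
  sInf ((fun y => maxNorm (x - y)) '' Ω)

theorem maxNorm_sub_le_maxNorm_sub (x y : EuclideanSpace ℝ (Fin 2)) :
    maxNorm x - maxNorm y ≤ maxNorm (x - y) := by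
  rw [sub_le_iff_le_add]
  refine max_le ?_ ?_
  · calc |x 0| ≤ |(x - y) 0| + |y 0| := by simpa using abs_add_le ((x - y) 0) (y 0)
      _ ≤ _ := add_le_add (le_max_left _ _) (le_max_left _ _)
  · calc |x 1| ≤ |(x - y) 1| + |y 1| := by simpa using abs_add_le ((x - y) 1) (y 1)
      _ ≤ _ := add_le_add (le_max_right _ _) (le_max_right _ _)

theorem maxNorm_smul (c : ℝ) (x : EuclideanSpace ℝ (Fin 2)) :
    maxNorm (c • x) = |c| * maxNorm x := by
  simp [maxNorm, abs_mul, mul_max_of_nonneg]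

/-- Outside a ball of the maximum norm centred at the origin, the distance to the ball is the
norm minus the radius. -/
theorem maxDist_maxNorm_ball {r : ℝ} (hr : 0 < r) {x : EuclideanSpace ℝ (Fin 2)}
    (hx : r ≤ maxNorm x) : maxDist {y | maxNorm y ≤ r} x = maxNorm x - r := by
  have hpos : 0 < maxNorm x := hr.trans_le hx
  refine IsLeast.csInf_eq ⟨⟨(r / maxNorm x) • x, ?_, ?_⟩, ?_⟩
  · rw [Set.mem_ofPred_eq, maxNorm_smul, abs_of_pos (div_pos hr hpos),
      div_mul_cancel₀ _ hpos.ne']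
  · have hsub : x - (r / maxNorm x) • x = (1 - r / maxNorm x) • x := by
      rw [sub_smul, one_smul]
    have hle : 0 ≤ 1 - r / maxNorm x := sub_nonneg.2 ((div_le_one hpos).2 hx)
    dsimp only
    rw [hsub, maxNorm_smul, abs_of_nonneg hle, sub_mul, one_mul, div_mul_cancel₀ _ hpos.ne']
  · rintro _ ⟨y, hy, rfl⟩
    exact (sub_le_sub_left hy _).trans (maxNorm_sub_le_maxNorm_sub x y)

/-- Example 3.4: For `Ω = {x : ‖x‖_∞ ≤ 1/2}` and `x₁ = (2,0)`, `x₂ = (2,1)` on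
the `ℓ∞`-sphere of radius `2`, there is no `σ > 0` for which the strong
quasiconvexity inequality for the `ℓ∞`-distance `d_Ω` holds along `[x₁,x₂]`. -/
theorem max_norm_distance_inequality_fails :
    maxNorm ((WithLp.equiv 2 (Fin 2 → ℝ)).symm ![2, 0]) = 2 ∧
    maxNorm ((WithLp.equiv 2 (Fin 2 → ℝ)).symm ![2, 1]) = 2 ∧
    ¬ ∃ σ > (0 : ℝ), ∀ l ∈ Set.Ioo (0 : ℝ) 1,
      maxDist {x : EuclideanSpace ℝ (Fin 2) | maxNorm x ≤ 1 / 2}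
          ((1 - l) • (WithLp.equiv 2 (Fin 2 → ℝ)).symm ![2, 0] +
            l • (WithLp.equiv 2 (Fin 2 → ℝ)).symm ![2, 1]) ≤
        max (maxDist {x : EuclideanSpace ℝ (Fin 2) | maxNorm x ≤ 1 / 2}
              ((WithLp.equiv 2 (Fin 2 → ℝ)).symm ![2, 0]))
            (maxDist {x : EuclideanSpace ℝ (Fin 2) | maxNorm x ≤ 1 / 2}
              ((WithLp.equiv 2 (Fin 2 → ℝ)).symm ![2, 1])) -
          σ / 2 * l * (1 - l) *
            ‖(WithLp.equiv 2 (Fin 2 → ℝ)).symm ![2, 0] -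
              (WithLp.equiv 2 (Fin 2 → ℝ)).symm ![2, 1]‖ ^ 2 := by
  have h₁ : maxNorm ((WithLp.equiv 2 (Fin 2 → ℝ)).symm ![2, 0]) = 2 := by simp [maxNorm]
  have h₂ : maxNorm ((WithLp.equiv 2 (Fin 2 → ℝ)).symm ![2, 1]) = 2 := by simp [maxNorm]
  refine ⟨h₁, h₂, ?_⟩
  rintro ⟨σ, hσ, h⟩
  have hmid : maxNorm ((1 - (1 / 2 : ℝ)) • (WithLp.equiv 2 (Fin 2 → ℝ)).symm ![2, 0] +
      (1 / 2 : ℝ) • (WithLp.equiv 2 (Fin 2 → ℝ)).symm ![2, 1]) = 2 := by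
    norm_num [maxNorm]
  have hne : ‖(WithLp.equiv 2 (Fin 2 → ℝ)).symm ![2, 0] -
      (WithLp.equiv 2 (Fin 2 → ℝ)).symm ![2, 1]‖ ^ 2 = 1 := by
    simp [EuclideanSpace.norm_sq_eq]
  have key := h (1 / 2) (by norm_num)
  rw [maxDist_maxNorm_ball (by norm_num) (by rw [hmid]; norm_num),
    maxDist_maxNorm_ball (by norm_num) (by rw [h₁]; norm_num),
    maxDist_maxNorm_ball (by norm_num) (by rw [h₂]; norm_num), hmid, h₁, h₂, hne, max_self] at key
  linarith
end

section
/- Equip ℝ² with the ℓ1-norm ‖(u,v)‖₁ = |u| + |v|, and let Ω = {x : ‖x‖₁ ≤ 1} be the closed unit ℓ1-ball. Let x₀ = (2,0) ∉ Ω. Then for every bounded neighborhood U of x₀ with U ∩ Ω = ∅ and every σ > 0, the distance function d_Ω(x) = inf{‖x−y‖₁ : y ∈ Ω} is not σ-strongly quasiconvex on U. -/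
/-- The `ℓ1`-norm on `ℝ²` (viewed as the Euclidean plane). -/
noncomputable def l1Norm (x : EuclideanSpace ℝ (Fin 2)) : ℝ := |x 0| + |x 1|

/-- The distance function to a set `Ω ⊆ ℝ²` with respect to the `ℓ1`-norm. -/
noncomputable def l1Dist (Ω : Set (EuclideanSpace ℝ (Fin 2)))
    (x : EuclideanSpace ℝ (Fin 2)) : ℝ :=
  sInf ((fun y => l1Norm (x - y)) '' Ω)

theorem l1Norm_sub_le (x y : EuclideanSpace ℝ (Fin 2)) :
    l1Norm x - l1Norm y ≤ l1Norm (x - y) := by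
  have h0 := abs_sub_abs_le_abs_sub (x 0) (y 0)
  have h1 := abs_sub_abs_le_abs_sub (x 1) (y 1)
  simp only [l1Norm, PiLp.sub_apply]
  linarith

theorem l1Norm_smul (c : ℝ) (x : EuclideanSpace ℝ (Fin 2)) :
    l1Norm (c • x) = |c| * l1Norm x := by
  simp only [l1Norm, PiLp.smul_apply, smul_eq_mul, abs_mul]
  ring

/-- Outside the closed unit `ℓ1`-ball, the `ℓ1`-distance to it is `‖x‖₁ - 1`. -/
theorem l1Dist_unitBall (x : EuclideanSpace ℝ (Fin 2)) (hx : 1 ≤ l1Norm x) :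
    l1Dist {y : EuclideanSpace ℝ (Fin 2) | l1Norm y ≤ 1} x = l1Norm x - 1 := by
  have hpos : 0 < l1Norm x := by linarith
  refine IsLeast.csInf_eq ⟨⟨(l1Norm x)⁻¹ • x, ?_, ?_⟩, ?_⟩
  · simp only [Set.mem_ofPred_eq, l1Norm_smul]
    rw [abs_of_pos (inv_pos.2 hpos), inv_mul_cancel₀ hpos.ne']
  · have h : x - (l1Norm x)⁻¹ • x = (1 - (l1Norm x)⁻¹) • x := by
      rw [sub_smul, one_smul]
    have h1 : 0 ≤ 1 - (l1Norm x)⁻¹ := sub_nonneg.2 (inv_le_one_of_one_le₀ hx)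
    simp only [h, l1Norm_smul, abs_of_nonneg h1]
    field_simp
  · rintro _ ⟨y, hy, rfl⟩
    have := l1Norm_sub_le x y
    simp only [Set.mem_ofPred_eq] at hy
    dsimp only
    linarith

/-- Example 3.6: For the closed unit `ℓ1`-ball `Ω ⊆ ℝ²` and the point
`x₀ = (2,0) ∉ Ω`, the `ℓ1`-distance function `d_Ω` is not `σ`-strongly
quasiconvex (with Euclidean penalty term) on any bounded neighborhood `U` of
`x₀` disjoint from `Ω`, for any `σ > 0`. -/
theorem l1_distance_not_locally_strongly_quasiconvex
    (U : Set (EuclideanSpace ℝ (Fin 2)))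
    (hU : U ∈ nhds ((WithLp.equiv 2 (Fin 2 → ℝ)).symm ![2, 0]))
    (hUbdd : Bornology.IsBounded U)
    (hUdisj : U ∩ {x : EuclideanSpace ℝ (Fin 2) | l1Norm x ≤ 1} = ∅)
    (σ : ℝ) (hσ : 0 < σ) :
    ¬ (∀ x ∈ U, ∀ y ∈ U, segment ℝ x y ⊆ U → ∀ l ∈ Set.Ioo (0 : ℝ) 1,
      l1Dist {x : EuclideanSpace ℝ (Fin 2) | l1Norm x ≤ 1} (l • x + (1 - l) • y) ≤
        max (l1Dist {x : EuclideanSpace ℝ (Fin 2) | l1Norm x ≤ 1} x)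
            (l1Dist {x : EuclideanSpace ℝ (Fin 2) | l1Norm x ≤ 1} y) -
          σ / 2 * l * (1 - l) * ‖x - y‖ ^ 2) := by
  intro h
  obtain ⟨ε, hε, hball⟩ := Metric.mem_nhds_iff.1 hU
  set a : EuclideanSpace ℝ (Fin 2) := (WithLp.equiv 2 (Fin 2 → ℝ)).symm ![2, 0] with ha
  obtain ⟨t, ht0, ht1, htε⟩ : ∃ t : ℝ, 0 < t ∧ t ≤ 1 ∧ t ≤ ε / 2 :=
    ⟨min 1 (ε / 2), by positivity, min_le_left _ _, min_le_right _ _⟩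
  set b : EuclideanSpace ℝ (Fin 2) := !₂[2 - t, t] with hb
  have a0 : a 0 = 2 := by simp [ha]
  have a1 : a 1 = 0 := by simp [ha]
  have b0 : b 0 = 2 - t := by simp [hb]
  have b1 : b 1 = t := by simp [hb]
  have hsq : ‖a - b‖ ^ 2 = 2 * t ^ 2 := by
    simp only [EuclideanSpace.norm_sq_eq, Fin.sum_univ_two, PiLp.sub_apply, a0, a1, b0, b1,
      Real.norm_eq_abs, sq_abs]
    ring
  have ha_mem : a ∈ Metric.ball a ε := Metric.mem_ball_self hε
  have hb_mem : b ∈ Metric.ball a ε := by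
    rw [Metric.mem_ball', dist_eq_norm]
    exact lt_of_pow_lt_pow_left₀ 2 hε.le (by nlinarith)
  have hNa : l1Norm a = 2 := by simp [l1Norm, a0, a1]
  have hNb : l1Norm b = 2 := by
    rw [l1Norm, b0, b1, abs_of_pos ht0, abs_of_nonneg (by linarith)]
    ring
  have hNm : l1Norm ((1 / 2 : ℝ) • a + (1 - 1 / 2 : ℝ) • b) = 2 := by
    simp only [l1Norm, PiLp.add_apply, PiLp.smul_apply, smul_eq_mul, a0, a1, b0, b1]
    rw [abs_of_nonneg (by linarith), abs_of_nonneg (by linarith)]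
    ring
  have key := h a (hball ha_mem) b (hball hb_mem)
    (((convex_ball a ε).segment_subset ha_mem hb_mem).trans hball) (1 / 2) (by norm_num)
  rw [l1Dist_unitBall _ (by rw [hNm]; norm_num), l1Dist_unitBall a (by rw [hNa]; norm_num),
    l1Dist_unitBall b (by rw [hNb]; norm_num), hNm, hNa, hNb, max_self, hsq] at key
  have : 0 < σ * t ^ 2 := by positivity
  linarith
end
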